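/- Let B ∈ (0,1), α ≥ 0, and α_f > 0. Define h : [0,1] → ℝ by h(y) = y(1 − ln y) for y > 0 and h(0) = 0, and set Γ = (1−B/2)·sup_{y∈(0,1]}(e^{−2α(1−B/2)y} + h(y) − 1). Define G_TS(y₁,y₂) = (1−B/2)·exp(−2α(1−B/2)y₁ − (α+α_f)(B/2)y₂) + (B/2)·exp(−(α+α_f)(1−B/2)y₁ − α_f B y₂) + (1−B/2)·h(y₁) + (B/2)·h(y₂) − 1, and G_Cross(z₁,z₂) = Γ·exp(−(B/2)(α+α_f)z₂) + (B/2)·exp(−Γ(α+α_f)z₁) + Γ·h(z₁) + (B/2)·h(z₂) − (Γ + B/2). Then for every fixed y ∈ [0,1], max_{y₁∈[0,1]} G_TS(y₁, y) ≤ max_{z₁∈[0,1]} G_Cross(z₁, y). -/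

import Mathlib

open Set

/-- `h(y) = y(1 − ln y)` for `y > 0`, extended by `h(0) = 0` (note that in
Mathlib `Real.log 0 = 0`, so the formula already gives `h 0 = 0`). -/
noncomputable def hfun (y : ℝ) : ℝ := y * (1 - Real.log y)

/-- `Γ = (1−B/2)·sup_{y∈(0,1]}(e^{−2α(1−B/2)y} + h(y) − 1)`. -/
noncomputable def Gam (B α : ℝ) : ℝ :=
  (1 - B/2) *
    sSup ((fun y => Real.exp (-(2*α*(1 - B/2)*y)) + hfun y - 1) '' Ioc 0 1)

/-- The two-sided objective after the change of variables `y_i = e^{−M_i t_i}`. -/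
noncomputable def GTS (B α αf y₁ y₂ : ℝ) : ℝ :=
  (1 - B/2) * Real.exp (-(2*α*(1 - B/2)*y₁) - (α + αf)*(B/2)*y₂)
  + (B/2) * Real.exp (-((α + αf)*(1 - B/2)*y₁) - αf*B*y₂)
  + (1 - B/2) * hfun y₁ + (B/2) * hfun y₂ - 1

/-- The cross objective after the change of variables `z_i = e^{−M′_i t_i}`. -/
noncomputable def GCross (B α αf z₁ z₂ : ℝ) : ℝ :=
  Gam B α * Real.exp (-((B/2)*(α + αf)*z₂))
  + (B/2) * Real.exp (-(Gam B α*(α + αf)*z₁))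
  + Gam B α * hfun z₁ + (B/2) * hfun z₂ - (Gam B α + B/2)


lemma hfun_le_one {x : ℝ} (hx : 0 ≤ x) : hfun x ≤ 1 := by
  unfold hfun
  rcases hx.eq_or_lt with h | h
  · subst h; simp
  · have h1 := Real.one_sub_inv_le_log_of_pos h
    have h2 := mul_le_mul_of_nonneg_left h1 hx
    rw [mul_sub, mul_inv_cancel₀ h.ne'] at h2
    linarith

/-- Algebraic combination: an inequality affine in `E`. -/
lemma affine_combine {E m b g A P Q H K : ℝ} (hE0 : 0 ≤ E) (hE1 : E ≤ 1)
    (h1 : m * A + b * P + m * H - m ≤ b * Q + m * g * K)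
    (h0 : b * P + m * H - m ≤ b * Q + m * g * K - m * g) :
    m * (A * E) + b * P + m * H - m ≤ m * g * E + b * Q + m * g * K - m * g := by
  have e1 := mul_le_mul_of_nonneg_left h1 hE0
  have e0 := mul_le_mul_of_nonneg_left h0 (sub_nonneg.2 hE1)
  nlinarith

lemma core {m b a s g : ℝ} (hm : 0 < m) (hb : 0 < b) (hs : 0 ≤ s)
    (hg0 : 0 < g) (hg1 : g ≤ 1)
    (hg : ∀ x ∈ Ioc (0:ℝ) 1, Real.exp (-(a*x)) + hfun x - 1 ≤ g)
    {x : ℝ} (hx : x ∈ Icc (0:ℝ) 1) {E : ℝ} (hE0 : 0 ≤ E) (hE1 : E ≤ 1) :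
    ∃ z ∈ Icc (0:ℝ) 1,
      m * (Real.exp (-(a*x)) * E) + b * Real.exp (-(s*m*x)) + m * hfun x - m
      ≤ m * g * E + b * Real.exp (-(m*g*s*z)) + m * g * hfun z - m * g := by
  obtain ⟨hx0, hx1⟩ := hx
  have hlg : g - 1 ≤ g * Real.log g := by
    have := hfun_le_one hg0.le
    unfold hfun at this
    linarith
  have hlg0 : Real.log g ≤ 0 := Real.log_nonpos hg0.le hg1
  rcases le_or_gt x g with hxg | hxg
  · refine ⟨x / g, ⟨by positivity, (div_le_one hg0).2 hxg⟩, ?_⟩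
    have hK : g * hfun (x / g) = hfun x + x * Real.log g := by
      unfold hfun
      rcases hx0.eq_or_lt with h | h
      · subst h; simp
      · rw [Real.log_div h.ne' hg0.ne']
        field_simp
        ring
    have hexp : m * g * s * (x / g) = s * m * x := by
      field_simp
    rw [hexp]
    have hxl : g * Real.log g ≤ x * Real.log g :=
      mul_le_mul_of_nonpos_right hxg hlg0
    have hkey : Real.exp (-(a*x)) - 1 ≤ x * Real.log g := by
      have hgg := hg g ⟨hg0, hg1⟩
      have hgg' : Real.exp (-(a*g)) - 1 ≤ g * Real.log g := by
        unfold hfun at hgg; linarith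
      have ht0 : 0 ≤ x / g := by positivity
      have ht1 : x / g ≤ 1 := (div_le_one hg0).2 hxg
      have hc := convexOn_exp.2 (mem_univ (0:ℝ)) (mem_univ (-(a*g)))
        (sub_nonneg.2 ht1) ht0 (by ring)
      simp only [smul_eq_mul, mul_zero, zero_add, Real.exp_zero, mul_one] at hc
      have e : x / g * -(a * g) = -(a * x) := by field_simp
      rw [e] at hc
      have h3 := mul_le_mul_of_nonneg_left hgg' ht0
      have e2 : x / g * (g * Real.log g) = x * Real.log g := by field_simp
      rw [e2] at h3
      linarith
    apply affine_combine hE0 hE1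
    · rw [mul_assoc m g, hK]
      nlinarith
    · rw [mul_assoc m g, hK]
      nlinarith
  · refine ⟨1, by simp, ?_⟩
    have h1 : hfun 1 = 1 := by simp [hfun]
    rw [h1]
    have hP : b * Real.exp (-(s*m*x)) ≤ b * Real.exp (-(m*g*s*1)) := by
      apply mul_le_mul_of_nonneg_left _ hb.le
      apply Real.exp_le_exp.2
      have := mul_le_mul_of_nonneg_left hxg.le (mul_nonneg hs hm.le)
      nlinarith
    apply affine_combine hE0 hE1
    · have := mul_le_mul_of_nonneg_left (hg x ⟨hg0.trans hxg, hx1⟩) hm.le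
      nlinarith
    · have := mul_le_mul_of_nonneg_left (hfun_le_one hx0) hm.le
      nlinarith

/-- For every fixed `y ∈ [0,1]`,
`max_{y₁∈[0,1]} G_TS(y₁,y) ≤ max_{z₁∈[0,1]} G_Cross(z₁,y)`. -/
theorem GTS_le_GCross_slicewise (B α αf : ℝ) (hB : B ∈ Ioo (0:ℝ) 1)
    (hα : 0 ≤ α) (hαf : 0 < αf) :
    ∀ y ∈ Icc (0:ℝ) 1,
      sSup ((fun y₁ => GTS B α αf y₁ y) '' Icc 0 1) ≤
      sSup ((fun z₁ => GCross B α αf z₁ y) '' Icc 0 1) := by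
  intro y hy
  obtain ⟨hB0, hB1⟩ := hB
  have hm : 0 < 1 - B/2 := by linarith
  have hb : 0 < B/2 := by linarith
  have hs : 0 ≤ α + αf := by linarith
  set S := (fun y => Real.exp (-(2*α*(1 - B/2)*y)) + hfun y - 1) '' Ioc (0:ℝ) 1 with hS
  have hub : ∀ v ∈ S, v ≤ 1 := by
    rintro _ ⟨x, hx, rfl⟩
    have h1 := hfun_le_one hx.1.le
    have h2 : Real.exp (-(2*α*(1 - B/2)*x)) ≤ 1 := by
      apply Real.exp_le_one_iff.2
      have := hx.1.le
      have : 0 ≤ 2*α*(1 - B/2)*x := by positivity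
      linarith
    simp only
    linarith
  have hmem : ∀ x ∈ Ioc (0:ℝ) 1,
      Real.exp (-(2*α*(1 - B/2)*x)) + hfun x - 1 ≤ sSup S := fun x hx =>
    le_csSup ⟨1, hub⟩ ⟨x, hx, rfl⟩
  have hg0 : 0 < sSup S := by
    have h := hmem 1 (by simp)
    have h1 : hfun 1 = 1 := by simp [hfun]
    rw [h1] at h
    have := Real.exp_pos (-(2*α*(1 - B/2)*1))
    linarith
  have hg1 : sSup S ≤ 1 := csSup_le ⟨_, 1, by simp, rfl⟩ hub
  have hG : Gam B α = (1 - B/2) * sSup S := rfl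
  have hG0 : 0 < Gam B α := by rw [hG]; positivity
  have hbdd : BddAbove ((fun z₁ => GCross B α αf z₁ y) '' Icc 0 1) := by
    refine ⟨Gam B α * Real.exp (-((B/2)*(α + αf)*y)) + (B/2) * 1
      + Gam B α * 1 + (B/2) * hfun y - (Gam B α + B/2), ?_⟩
    rintro _ ⟨z, hz, rfl⟩
    have h1 := mul_le_mul_of_nonneg_left (hfun_le_one hz.1) hG0.le
    have h2 : Real.exp (-(Gam B α*(α + αf)*z)) ≤ 1 := by
      apply Real.exp_le_one_iff.2
      have := hz.1
      have : 0 ≤ Gam B α*(α + αf)*z := by positivity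
      linarith
    have h3 := mul_le_mul_of_nonneg_left h2 hb.le
    simp only [GCross]
    linarith
  refine csSup_le ⟨_, 1, by simp, rfl⟩ ?_
  rintro _ ⟨x, hx, rfl⟩
  have hE1 : Real.exp (-((B/2)*(α + αf)*y)) ≤ 1 := by
    apply Real.exp_le_one_iff.2
    have := hy.1
    have : 0 ≤ (B/2)*(α + αf)*y := by positivity
    linarith
  obtain ⟨z, hz, hle⟩ := core hm hb hs hg0 hg1 hmem hx (Real.exp_pos _).le hE1
  refine le_trans ?_ (le_csSup hbdd ⟨z, hz, rfl⟩)
  simp only [GTS, GCross]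
  rw [← hG, ← Real.exp_add] at hle
  have e1 : -(2*α*(1 - B/2)*x) - (α + αf)*(B/2)*y
      = -(2*α*(1 - B/2)*x) + -((B/2)*(α + αf)*y) := by ring
  rw [e1]
  have hD : (B/2) * Real.exp (-((α + αf)*(1 - B/2)*x) - αf*B*y)
      ≤ (B/2) * Real.exp (-((α + αf)*(1 - B/2)*x)) := by
    apply mul_le_mul_of_nonneg_left _ hb.le
    apply Real.exp_le_exp.2
    have := hy.1
    have : 0 ≤ αf*B*y := by positivity
    linarith
  linarith
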